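/- arXiv:1908.05173 — 3 statements merged into one kernel-verified Lean document; each statement's English description precedes it below -/
import Mathlib

section
/- Let f ∈ ℝ[x,y] be of the form x²·y + E·x² + F·x·y + G·y² + λ, where E, F, G ∈ ℝ and λ ∈ ℝ[x,y] has total degree at most 1. Then there exist an affine automorphism θ ∈ Γ₂(ℝ) and a nonzero real number c such that θ(f) = c·g, where g is one of the following polynomials: x²·y + y² − x + I·y + J with I, J ∈ ℝ; x²·y + y² + ε·y + J with ε ∈ {1, −1} and J ∈ ℝ; x²·y + y² + ε with ε ∈ {1, −1}; x²·y + y²; x²·y − x + ε·y + J with ε ∈ {1, −1} and J ≥ 0; x²·y + ε·y + 1 with ε ∈ {1, −1}; x²·y + ε·y with ε ∈ {1, −1}; x²·y − x + 1; x²·y − x; x²·y − 1; or x²·y. -/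
open MvPolynomial

/-- The polynomial ring `ℝ[x,y]`, realized as `MvPolynomial (Fin 2) ℝ`
with `X 0 = x` and `X 1 = y`. -/
abbrev P2 : Type := MvPolynomial (Fin 2) ℝ

/-- `f ∼ g` : there are an affine automorphism `θ ∈ Γ₂(ℝ)` (a ring automorphism
of `ℝ[x,y]` sending `x` and `y` to polynomials of total degree at most 1)
and a nonzero `c ∈ ℝ` with `θ f = c • g`. -/
def AffEquiv (f g : P2) : Prop :=
  ∃ θ : P2 ≃+* P2, (θ (X 0)).totalDegree ≤ 1 ∧ (θ (X 1)).totalDegree ≤ 1 ∧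
    ∃ c : ℝ, c ≠ 0 ∧ θ f = C c * g

/-- `f ≈ g` : there are a ring automorphism `φ` of `ℝ[x,y]` and a nonzero
`c ∈ ℝ` with `φ f = c • g`. -/
def AutEquiv (f g : P2) : Prop :=
  ∃ φ : P2 ≃+* P2, ∃ c : ℝ, c ≠ 0 ∧ φ f = C c * g

/-- The table entries with canonical form `x²·y`. -/
def FamC (p : P2) : Prop :=
  (∃ I J : ℝ, p = X 0 ^ 2 * X 1 + X 1 ^ 2 - X 0 + C I * X 1 + C J) ∨
  (∃ e J : ℝ, (e = 1 ∨ e = -1) ∧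
    p = X 0 ^ 2 * X 1 + X 1 ^ 2 + C e * X 1 + C J) ∨
  (∃ e : ℝ, (e = 1 ∨ e = -1) ∧ p = X 0 ^ 2 * X 1 + X 1 ^ 2 + C e) ∨
  p = X 0 ^ 2 * X 1 + X 1 ^ 2 ∨
  (∃ e J : ℝ, (e = 1 ∨ e = -1) ∧ 0 ≤ J ∧
    p = X 0 ^ 2 * X 1 - X 0 + C e * X 1 + C J) ∨
  (∃ e : ℝ, (e = 1 ∨ e = -1) ∧ p = X 0 ^ 2 * X 1 + C e * X 1 + 1) ∨
  (∃ e : ℝ, (e = 1 ∨ e = -1) ∧ p = X 0 ^ 2 * X 1 + C e * X 1) ∨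
  p = X 0 ^ 2 * X 1 - X 0 + 1 ∨
  p = X 0 ^ 2 * X 1 - X 0 ∨
  p = X 0 ^ 2 * X 1 - 1 ∨
  p = X 0 ^ 2 * X 1

/-- The substitution `x ↦ αx + s`, `y ↦ βy + t`. -/
noncomputable def diagSubst (α β s t : ℝ) : P2 →ₐ[ℝ] P2 :=
  aeval ![C α * X 0 + C s, C β * X 1 + C t]

lemma diagSubst_comp {α β : ℝ} (hα : α ≠ 0) (hβ : β ≠ 0) (s t : ℝ) :
    (diagSubst α β s t).comp (diagSubst α⁻¹ β⁻¹ (-(α⁻¹ * s)) (-(β⁻¹ * t))) =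
      AlgHom.id ℝ P2 := by
  have h1 : (C α⁻¹ * C α : P2) = 1 := by rw [← C_mul, inv_mul_cancel₀ hα, C_1]
  have h2 : (C β⁻¹ * C β : P2) = 1 := by rw [← C_mul, inv_mul_cancel₀ hβ, C_1]
  apply algHom_ext
  intro i
  fin_cases i
  · simp [diagSubst, algebraMap_eq]
    linear_combination X 0 * h1
  · simp [diagSubst, algebraMap_eq]
    linear_combination X 1 * h2

lemma diagSubst_comp' {α β : ℝ} (hα : α ≠ 0) (hβ : β ≠ 0) (s t : ℝ) :
    (diagSubst α⁻¹ β⁻¹ (-(α⁻¹ * s)) (-(β⁻¹ * t))).comp (diagSubst α β s t) =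
      AlgHom.id ℝ P2 := by
  have h := diagSubst_comp (inv_ne_zero hα) (inv_ne_zero hβ) (-(α⁻¹ * s)) (-(β⁻¹ * t))
  simpa [hα, hβ] using h

lemma totalDegree_C_mul_X_add_C_le (a b : ℝ) (i : Fin 2) :
    (C a * X i + C b : P2).totalDegree ≤ 1 := by
  refine (totalDegree_add _ _).trans (max_le ?_ (by simp))
  refine (totalDegree_mul _ _).trans ?_
  simp

lemma affEquiv_of_diagSubst {α β s t c : ℝ} {f g : P2} (hα : α ≠ 0) (hβ : β ≠ 0) (hc : c ≠ 0)
    (h : diagSubst α β s t f = C c * g) : AffEquiv f g := by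
  refine ⟨(AlgEquiv.ofAlgHom _ _ (diagSubst_comp hα hβ s t)
    (diagSubst_comp' hα hβ s t)).toRingEquiv, ?_, ?_, c, hc, h⟩
  · simpa [diagSubst] using totalDegree_C_mul_X_add_C_le α s 0
  · simpa [diagSubst] using totalDegree_C_mul_X_add_C_le β t 1

/-- Normalization of a cubic with leading form `x²y`: translating by `(-F/2, -E)` and rescaling
the coordinates by `α` and `β`. -/
lemma affEquiv_normalize {E F G a b d α β p q r u : ℝ} (hα : α ≠ 0) (hβ : β ≠ 0)
    (hp : G * β = α ^ 2 * p)
    (hq : a - E * F = α * β * q)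
    (hr : b - F ^ 2 / 4 - 2 * G * E = α ^ 2 * r)
    (hu : F ^ 2 * E / 2 + G * E ^ 2 - a * F / 2 - b * E + d = α ^ 2 * β * u) :
    AffEquiv (X 0 ^ 2 * X 1 + C E * X 0 ^ 2 + C F * X 0 * X 1 + C G * X 1 ^ 2 +
        (C a * X 0 + C b * X 1 + C d))
      (X 0 ^ 2 * X 1 + C p * X 1 ^ 2 + C q * X 0 + C r * X 1 + C u) := by
  obtain ⟨m, rfl⟩ : ∃ m, F = 2 * m := ⟨F / 2, by ring⟩
  have hp' := congrArg (C : ℝ → P2) hp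
  have hq' := congrArg (C : ℝ → P2) hq
  have hr' := congrArg (C : ℝ → P2)
    (show b - m ^ 2 - 2 * G * E = α ^ 2 * r by linear_combination hr)
  have hu' := congrArg (C : ℝ → P2)
    (show 2 * m ^ 2 * E + G * E ^ 2 - a * m - b * E + d = α ^ 2 * β * u by
      linear_combination hu)
  have h2 : (C (2 : ℝ) : P2) = 2 := map_ofNat C 2
  simp only [map_mul, map_sub, map_add, map_pow, h2] at hp' hq' hr' hu'
  refine affEquiv_of_diagSubst (s := -m) (t := -E) (c := α ^ 2 * β) hα hβ (by positivity) ?_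
  simp [diagSubst, algebraMap_eq]
  simp only [h2]
  linear_combination (C β * X 1 ^ 2) * hp' + (C α * X 0) * hq' + (C β * X 1) * hr' + hu'

lemma exists_eq_linear_of_totalDegree_le_one {p : P2} (hp : p.totalDegree ≤ 1) :
    ∃ a b d : ℝ, p = C a * X 0 + C b * X 1 + C d := by
  refine ⟨p.coeff (Finsupp.single 0 1), p.coeff (Finsupp.single 1 1), p.coeff 0, ?_⟩
  have h01 : (Finsupp.single 0 1 : Fin 2 →₀ ℕ) ≠ Finsupp.single 1 1 := by
    simp [Finsupp.single_left_inj]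
  ext m
  simp only [coeff_add, coeff_C_mul, coeff_X, coeff_C]
  by_cases h0 : m = 0
  · subst h0
    simp
  by_cases h1 : m = Finsupp.single 0 1
  · subst h1
    simp [h01.symm, Ne.symm h0]
  by_cases h2 : m = Finsupp.single 1 1
  · subst h2
    simp [h01, Ne.symm h0]
  simp only [Ne.symm h0, Ne.symm h1, Ne.symm h2, if_false, mul_zero, add_zero]
  by_contra hm
  have hle := (le_totalDegree (mem_support_iff.2 hm)).trans hp
  rw [Finsupp.sum_fintype _ _ (fun _ => rfl), Fin.sum_univ_two] at hle
  have hcases : (m 0 = 0 ∧ m 1 = 0) ∨ (m 0 = 1 ∧ m 1 = 0) ∨ (m 0 = 0 ∧ m 1 = 1) := by omega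
  rcases hcases with ⟨h, h'⟩ | ⟨h, h'⟩ | ⟨h, h'⟩
  · exact h0 (by ext i; fin_cases i <;> simp [h, h'])
  · exact h1 (by ext i; fin_cases i <;> simp [h, h'])
  · exact h2 (by ext i; fin_cases i <;> simp [h, h'])

lemma exists_cube_eq (x : ℝ) : ∃ y : ℝ, y ^ 3 = x := by
  rcases le_total 0 x with h | h
  · exact ⟨x ^ ((3 : ℕ) : ℝ)⁻¹, Real.rpow_inv_natCast_pow h (by norm_num)⟩
  · refine ⟨-(-x) ^ ((3 : ℕ) : ℝ)⁻¹, ?_⟩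
    rw [Odd.neg_pow (by decide), Real.rpow_inv_natCast_pow (by linarith) (by norm_num), neg_neg]

lemma exists_sq_mul_sign_eq {b : ℝ} (hb : b ≠ 0) :
    ∃ α e : ℝ, α ≠ 0 ∧ (e = 1 ∨ e = -1) ∧ b = α ^ 2 * e := by
  rcases lt_or_gt_of_ne hb with h | h
  · refine ⟨√(-b), -1, (Real.sqrt_pos.2 (by linarith)).ne', Or.inr rfl, ?_⟩
    rw [Real.sq_sqrt (by linarith)]; ring
  · refine ⟨√b, 1, (Real.sqrt_pos.2 h).ne', Or.inl rfl, ?_⟩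
    rw [Real.sq_sqrt h.le]; ring

/-- Every `x²y + Gy² + ax + by + d` can be rescaled to a member of the table. -/
lemma exists_scaling_famC (G a b d : ℝ) :
    ∃ α β p q r u : ℝ, α ≠ 0 ∧ β ≠ 0 ∧ G * β = α ^ 2 * p ∧ a = α * β * q ∧ b = α ^ 2 * r ∧
      d = α ^ 2 * β * u ∧
      FamC (X 0 ^ 2 * X 1 + C p * X 1 ^ 2 + C q * X 0 + C r * X 1 + C u) := by
  have hm : (C (-1 : ℝ) : P2) = -1 := by simp
  by_cases hG : G = 0
  · subst hG
    by_cases ha : a = 0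
    · subst ha
      by_cases hb : b = 0
      · subst hb
        by_cases hd : d = 0
        · subst hd
          refine ⟨1, 1, 0, 0, 0, 0, by simp, by simp, by simp, by simp, by simp, by simp, ?_⟩
          iterate 10 right
          simp
        · refine ⟨1, -d, 0, 0, 0, -1, by simp, by simpa, by simp, by simp, by simp, by simp, ?_⟩
          iterate 9 right
          left
          simp [sub_eq_add_neg]
      · obtain ⟨α, e, hα, he, rfl⟩ := exists_sq_mul_sign_eq hb
        by_cases hd : d = 0
        · subst hd
          refine ⟨α, 1, 0, 0, e, 0, hα, by simp, by simp, by simp, by simp, by simp, ?_⟩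
          iterate 6 right
          left
          exact ⟨e, he, by simp⟩
        · refine ⟨α, d / α ^ 2, 0, 0, e, 1, hα, by positivity, by simp, by simp, by simp,
            by field_simp, ?_⟩
          iterate 5 right
          left
          exact ⟨e, he, by simp⟩
    · by_cases hb : b = 0
      · subst hb
        by_cases hd : d = 0
        · subst hd
          refine ⟨1, -a, 0, -1, 0, 0, by simp, by simpa, by simp, by simp, by simp, by simp, ?_⟩
          iterate 8 right
          left
          simp [sub_eq_add_neg]
        · refine ⟨-d / a, a ^ 2 / d, 0, -1, 0, 1, by simp [ha, hd], by positivity, by simp,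
            by field_simp, by simp, by field_simp, ?_⟩
          iterate 7 right
          left
          simp [sub_eq_add_neg]
      · obtain ⟨α, e, hα, he, rfl⟩ := exists_sq_mul_sign_eq hb
        obtain ⟨γ, hγ, hsq, hpos⟩ : ∃ γ : ℝ, γ ≠ 0 ∧ α ^ 2 = γ ^ 2 ∧ 0 ≤ -d / (γ * a) := by
          rcases le_total 0 (-d / (α * a)) with h | h
          · exact ⟨α, hα, rfl, h⟩
          · refine ⟨-α, by simpa, by ring, ?_⟩
            rw [neg_mul, div_neg]
            linarith
        refine ⟨γ, -a / γ, 0, -1, e, -d / (γ * a), hγ, by simp [ha, hγ], by simp,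
          by field_simp, by rw [hsq], by field_simp, ?_⟩
        iterate 4 right
        left
        refine ⟨e, _, he, hpos, ?_⟩
        rw [hm, C_0]
        ring
  · by_cases ha : a = 0
    · subst ha
      by_cases hb : b = 0
      · subst hb
        by_cases hd : d = 0
        · subst hd
          refine ⟨1, 1 / G, 1, 0, 0, 0, by simp, by simpa, by field_simp, by simp, by simp,
            by simp, ?_⟩
          iterate 3 right
          left
          simp
        · obtain ⟨γ, e, hγ, he, h⟩ := exists_sq_mul_sign_eq (mul_ne_zero hd hG)
          refine ⟨√|γ|, |γ| / G, 1, 0, 0, e, (Real.sqrt_pos.2 (abs_pos.2 hγ)).ne',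
            by simp [hγ, hG], ?_, by simp, by simp, ?_, ?_⟩
          · rw [Real.sq_sqrt (abs_nonneg _)]
            field_simp
          · rw [Real.sq_sqrt (abs_nonneg _)]
            field_simp
            rw [sq_abs, h]
          · iterate 2 right
            left
            exact ⟨e, he, by simp⟩
      · obtain ⟨α, e, hα, he, rfl⟩ := exists_sq_mul_sign_eq hb
        refine ⟨α, α ^ 2 / G, 1, 0, e, d * G / α ^ 4, hα, by positivity, by field_simp, by simp,
          by simp, by field_simp, ?_⟩
        right
        left
        exact ⟨e, d * G / α ^ 4, he, by simp⟩
    · obtain ⟨α, h⟩ := exists_cube_eq (-(a * G))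
      have hα : α ≠ 0 := by
        rintro rfl
        simp [ha, hG] at h
      refine ⟨α, α ^ 2 / G, 1, -1, b / α ^ 2, d * G / α ^ 4, hα, by positivity, by field_simp,
        ?_, by field_simp, by field_simp, ?_⟩
      · field_simp
        linear_combination h
      · left
        refine ⟨b / α ^ 2, d * G / α ^ 4, ?_⟩
        rw [hm, C_1]
        ring

theorem stmt2 (E F G : ℝ) (lam : P2) (hlam : lam.totalDegree ≤ 1) :
    ∃ g : P2, FamC g ∧
      AffEquiv (X 0 ^ 2 * X 1 + C E * X 0 ^ 2 + C F * X 0 * X 1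
        + C G * X 1 ^ 2 + lam) g := by
  obtain ⟨a, b, d, rfl⟩ := exists_eq_linear_of_totalDegree_le_one hlam
  obtain ⟨α, β, p, q, r, u, hα, hβ, hp, hq, hr, hu, hg⟩ := exists_scaling_famC G (a - E * F)
    (b - F ^ 2 / 4 - 2 * G * E) (F ^ 2 * E / 2 + G * E ^ 2 - a * F / 2 - b * E + d)
  exact ⟨_, hg, affEquiv_normalize hα hβ hp hq hr hu⟩
end

section
/- Let f ∈ ℝ[x,y] be of the form x³ + E·x² + F·x·y + G·y² + λ, where E, F, G ∈ ℝ and λ ∈ ℝ[x,y] has total degree at most 1. Then there exist an affine automorphism θ ∈ Γ₂(ℝ) and a nonzero real number c such that θ(f) = c·g, where g is one of the following polynomials: x³ − y² + ε·x + J with ε ∈ {1, −1} and J ∈ ℝ; x³ − y² + ε with ε ∈ {1, −1}; x³ − y²; x³ − y; x³ − x·y + 1; x³ − x·y; x³ + ε·x + J with ε ∈ {1, −1} and J ≥ 0; x³ + 1; or x³. -/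
open MvPolynomial

/-- The table entries with canonical form `x³`. -/
def FamD (p : P2) : Prop :=
  (∃ e J : ℝ, (e = 1 ∨ e = -1) ∧
    p = X 0 ^ 3 - X 1 ^ 2 + C e * X 0 + C J) ∨
  (∃ e : ℝ, (e = 1 ∨ e = -1) ∧ p = X 0 ^ 3 - X 1 ^ 2 + C e) ∨
  p = X 0 ^ 3 - X 1 ^ 2 ∨
  p = X 0 ^ 3 - X 1 ∨
  p = X 0 ^ 3 - X 0 * X 1 + 1 ∨
  p = X 0 ^ 3 - X 0 * X 1 ∨
  (∃ e J : ℝ, (e = 1 ∨ e = -1) ∧ 0 ≤ J ∧ p = X 0 ^ 3 + C e * X 0 + C J) ∨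
  p = X 0 ^ 3 + 1 ∨
  p = X 0 ^ 3

/-- A function of two real variables becomes a nonzero multiple of another one after an
invertible lower triangular affine substitution. -/
def TriangularEquiv (f g : ℝ → ℝ → ℝ) : Prop :=
  ∃ p q r s t c : ℝ, p ≠ 0 ∧ q ≠ 0 ∧ c ≠ 0 ∧
    ∀ x y, f (p * x + r) (s * x + q * y + t) = c * g x y

theorem TriangularEquiv.trans {f g h : ℝ → ℝ → ℝ} (hfg : TriangularEquiv f g)
    (hgh : TriangularEquiv g h) : TriangularEquiv f h := by
  obtain ⟨p, q, r, s, t, c, hp, hq, hc, H⟩ := hfg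
  obtain ⟨p', q', r', s', t', c', hp', hq', hc', H'⟩ := hgh
  refine ⟨p * p', q * q', p * r' + r, s * p' + q * s', s * r' + q * t' + t, c * c',
    mul_ne_zero hp hp', mul_ne_zero hq hq', mul_ne_zero hc hc', fun x y => ?_⟩
  rw [mul_assoc c, ← H', ← H]
  congr 1 <;> ring

/-- The lower triangular affine automorphism `x ↦ p x + r`, `y ↦ s x + q y + t`. -/
noncomputable def triangularAut (p q r s t : ℝ) (hp : p ≠ 0) (hq : q ≠ 0) : P2 ≃ₐ[ℝ] P2 :=
  AlgEquiv.ofAlgHom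
    (aeval ![C p * X 0 + C r, C s * X 0 + C q * X 1 + C t])
    (aeval ![C p⁻¹ * X 0 + C (-(p⁻¹ * r)),
      C (-(q⁻¹ * s * p⁻¹)) * X 0 + C q⁻¹ * X 1 + C (q⁻¹ * (s * p⁻¹ * r - t))])
    (by
      refine MvPolynomial.algHom_ext fun i => MvPolynomial.funext fun v => ?_
      fin_cases i <;> simp <;> field_simp <;> ring)
    (by
      refine MvPolynomial.algHom_ext fun i => MvPolynomial.funext fun v => ?_
      fin_cases i <;> simp <;> field_simp <;> ring)

theorem TriangularEquiv.affEquiv {f g : P2}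
    (h : TriangularEquiv (fun x y => eval ![x, y] f) (fun x y => eval ![x, y] g)) :
    AffEquiv f g := by
  obtain ⟨p, q, r, s, t, c, hp, hq, hc, H⟩ := h
  have hmon : ∀ (a : ℝ) (i : Fin 2), (C a * X i : P2).totalDegree ≤ 1 := fun a i =>
    (totalDegree_mul _ _).trans (by simp)
  have hC : ∀ a : ℝ, (C a : P2).totalDegree ≤ 1 := fun a => by simp
  refine ⟨(triangularAut p q r s t hp hq).toRingEquiv, ?_, ?_, c, hc, ?_⟩
  · have : triangularAut p q r s t hp hq (X 0) = C p * X 0 + C r := by simp [triangularAut]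
    change (triangularAut p q r s t hp hq (X 0)).totalDegree ≤ 1
    rw [this]
    exact (totalDegree_add _ _).trans (max_le (hmon _ _) (hC _))
  · have : triangularAut p q r s t hp hq (X 1) = C s * X 0 + C q * X 1 + C t := by
      simp [triangularAut]
    change (triangularAut p q r s t hp hq (X 1)).totalDegree ≤ 1
    rw [this]
    exact (totalDegree_add _ _).trans
      (max_le ((totalDegree_add _ _).trans (max_le (hmon _ _) (hmon _ _))) (hC _))
  · change aeval ![C p * X 0 + C r, C s * X 0 + C q * X 1 + C t] f = C c * g
    refine MvPolynomial.funext fun v => ?_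
    have key : ∀ φ : Fin 2 → P2, eval v (aeval φ f) = eval (fun i => eval v (φ i)) f := by
      intro φ
      clear H
      induction f using MvPolynomial.induction_on with
      | C a => simp
      | add a b ha hb => simp only [map_add, ha, hb]
      | mul_X a i ha => simp only [map_mul, ha, aeval_X, eval_X]
    have hv : ![v 0, v 1] = v := by ext i; fin_cases i <;> rfl
    have h := H (v 0) (v 1)
    simp only [hv] at h
    rw [key, map_mul, eval_C, ← h]
    congr 2
    ext i
    fin_cases i <;> simp

theorem exists_eval_eq_of_totalDegree_le_one {l : P2} (hl : l.totalDegree ≤ 1) :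
    ∃ a b d : ℝ, ∀ x y, eval ![x, y] l = a * x + b * y + d := by
  refine ⟨coeff (Finsupp.single 0 1) l, coeff (Finsupp.single 1 1) l, coeff 0 l, fun x y => ?_⟩
  have hs : l.support ⊆ {Finsupp.single 0 1, Finsupp.single 1 1, 0} := by
    intro m hm
    have h := (le_totalDegree hm).trans hl
    rw [Finsupp.sum_fintype _ _ (fun _ => rfl), Fin.sum_univ_two] at h
    simp only [Finset.mem_insert, Finset.mem_singleton, Finsupp.ext_iff, Fin.forall_fin_two]
    simp
    omega
  have h01 : (Finsupp.single 0 1 : Fin 2 →₀ ℕ) ≠ Finsupp.single 1 1 := by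
    simp [Finsupp.single_left_inj]
  rw [eval_eq', Finset.sum_subset hs fun m _ hm => by simp [notMem_support_iff.1 hm]]
  rw [Finset.sum_insert (by simp [h01]), Finset.sum_insert (by simp), Finset.sum_singleton]
  simp [Finsupp.single_apply]
  ring

theorem exists_cube_eq_s3 {d : ℝ} (hd : d ≠ 0) : ∃ p : ℝ, p ≠ 0 ∧ p ^ 3 = d := by
  have pos : ∀ e : ℝ, 0 < e → ∃ p : ℝ, p ^ 3 = e := fun e he =>
    ⟨e ^ ((3 : ℕ) : ℝ)⁻¹, Real.rpow_inv_natCast_pow he.le (by norm_num)⟩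
  obtain ⟨p, hp⟩ : ∃ p : ℝ, p ^ 3 = d := by
    rcases hd.lt_or_gt with h | h
    · obtain ⟨p, hp⟩ := pos (-d) (by linarith)
      exact ⟨-p, by linear_combination -hp⟩
    · exact pos d h
  exact ⟨p, by rintro rfl; exact hd (by simpa using hp.symm), hp⟩

/-- A nonzero real is a sign times the square of a real whose sign may be prescribed. -/
theorem exists_sq_mul_sign_eq_s3 {a : ℝ} (ha : a ≠ 0) (k : ℝ) :
    ∃ p e : ℝ, p ≠ 0 ∧ (e = 1 ∨ e = -1) ∧ a = e * p ^ 2 ∧ 0 ≤ k * p := by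
  obtain ⟨e, he, hea⟩ : ∃ e : ℝ, (e = 1 ∨ e = -1) ∧ a = e * √|a| ^ 2 := by
    rw [Real.sq_sqrt (abs_nonneg a)]
    rcases abs_choice a with h | h
    · exact ⟨1, .inl rfl, by rw [h]; ring⟩
    · exact ⟨-1, .inr rfl, by rw [h]; ring⟩
  have hs : 0 < √|a| := Real.sqrt_pos.2 (abs_pos.2 ha)
  rcases le_total 0 k with hk | hk
  · exact ⟨√|a|, e, hs.ne', he, hea, mul_nonneg hk hs.le⟩
  · exact ⟨-√|a|, e, neg_ne_zero.2 hs.ne', he, by rw [neg_sq]; exact hea,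
      mul_nonneg_of_nonpos_of_nonpos hk (by linarith)⟩

theorem exists_famD_of_cubic_add_sq {G : ℝ} (hG : G ≠ 0) (a d : ℝ) :
    ∃ g : P2, FamD g ∧ TriangularEquiv (fun x y => x ^ 3 + a * x + G * y ^ 2 + d)
      (fun x y => eval ![x, y] g) := by
  have root : ∀ p : ℝ, p ≠ 0 → 0 ≤ -G * p → ∃ q : ℝ, q ≠ 0 ∧ G * q ^ 2 = -p ^ 3 := by
    intro p hp h
    have h1 : 0 < -p ^ 3 / G := by
      have h2 : 0 < -G * p := lt_of_le_of_ne h (mul_ne_zero (neg_ne_zero.2 hG) hp).symm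
      have : -p ^ 3 / G = (-G * p) * (p / G) ^ 2 := by field_simp
      rw [this]
      positivity
    exact ⟨√(-p ^ 3 / G), (Real.sqrt_pos.2 h1).ne', by
      rw [Real.sq_sqrt h1.le]; field_simp⟩
  by_cases ha : a = 0
  · subst ha
    by_cases hd : d = 0
    · subst hd
      refine ⟨_, .inr (.inr (.inl rfl)), -G, G, 0, 0, 0, -G ^ 3, neg_ne_zero.2 hG, hG,
        neg_ne_zero.2 (pow_ne_zero 3 hG), fun x y => ?_⟩
      simp
      ring
    · obtain ⟨p, hp, hpd⟩ := exists_cube_eq_s3 hd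
      obtain ⟨e, he, hep⟩ : ∃ e : ℝ, (e = 1 ∨ e = -1) ∧ 0 ≤ -G * (e * p) := by
        rcases le_total 0 (-G * p) with h | h
        · exact ⟨1, .inl rfl, by linarith⟩
        · exact ⟨-1, .inr rfl, by linarith⟩
      have he0 : e ≠ 0 := by rcases he with rfl | rfl <;> norm_num
      have he2 : e ^ 2 = 1 := by rcases he with rfl | rfl <;> norm_num
      obtain ⟨q, hq, hGq⟩ := root (e * p) (mul_ne_zero he0 hp) hep
      refine ⟨_, .inr (.inl ⟨e, he, rfl⟩), e * p, q, 0, 0, 0, (e * p) ^ 3,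
        mul_ne_zero he0 hp, hq, pow_ne_zero 3 (mul_ne_zero he0 hp), fun x y => ?_⟩
      simp
      linear_combination y ^ 2 * hGq - hpd - p ^ 3 * (e ^ 2 + 1) * he2
  · obtain ⟨p, e, hp, he, hap, hGp⟩ := exists_sq_mul_sign_eq_s3 ha (-G)
    obtain ⟨q, hq, hGq⟩ := root p hp hGp
    refine ⟨_, .inl ⟨e, d / p ^ 3, he, rfl⟩, p, q, 0, 0, 0, p ^ 3, hp, hq,
      pow_ne_zero 3 hp, fun x y => ?_⟩
    have hd : p ^ 3 * (d / p ^ 3) = d := by field_simp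
    simp
    linear_combination y ^ 2 * hGq + p * x * hap - hd

theorem exists_famD_of_cubic_add_mul (d : ℝ) :
    ∃ g : P2, FamD g ∧ TriangularEquiv (fun x y => x ^ 3 - x * y + d)
      (fun x y => eval ![x, y] g) := by
  by_cases hd : d = 0
  · subst hd
    refine ⟨_, .inr (.inr (.inr (.inr (.inr (.inl rfl))))), 1, 1, 0, 0, 0, 1,
      one_ne_zero, one_ne_zero, one_ne_zero, fun x y => ?_⟩
    simp
  · obtain ⟨p, hp, hpd⟩ := exists_cube_eq_s3 hd
    refine ⟨_, .inr (.inr (.inr (.inr (.inl rfl)))), p, p ^ 2, 0, 0, 0, p ^ 3,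
      hp, pow_ne_zero 2 hp, pow_ne_zero 3 hp, fun x y => ?_⟩
    simp
    linear_combination -hpd

theorem exists_famD_of_cubic (a d : ℝ) :
    ∃ g : P2, FamD g ∧ TriangularEquiv (fun x _ => x ^ 3 + a * x + d)
      (fun x y => eval ![x, y] g) := by
  by_cases ha : a = 0
  · subst ha
    by_cases hd : d = 0
    · subst hd
      refine ⟨_, .inr (.inr (.inr (.inr (.inr (.inr (.inr (.inr rfl))))))), 1, 1, 0, 0, 0, 1,
        one_ne_zero, one_ne_zero, one_ne_zero, fun x y => ?_⟩
      simp
    · obtain ⟨p, hp, hpd⟩ := exists_cube_eq_s3 hd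
      refine ⟨_, .inr (.inr (.inr (.inr (.inr (.inr (.inr (.inl rfl))))))), p, 1, 0, 0, 0, p ^ 3,
        hp, one_ne_zero, pow_ne_zero 3 hp, fun x y => ?_⟩
      simp
      linear_combination -hpd
  · obtain ⟨p, e, hp, he, hap, hdp⟩ := exists_sq_mul_sign_eq_s3 ha d
    have hJ : 0 ≤ d / p ^ 3 := by
      have : d / p ^ 3 = d * p * ((p ^ 2)⁻¹) ^ 2 := by field_simp
      rw [this]
      positivity
    refine ⟨_, .inr (.inr (.inr (.inr (.inr (.inr (.inl ⟨e, d / p ^ 3, he, hJ, rfl⟩)))))),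
      p, 1, 0, 0, 0, p ^ 3, hp, one_ne_zero, pow_ne_zero 3 hp, fun x y => ?_⟩
    have hd : p ^ 3 * (d / p ^ 3) = d := by field_simp
    simp
    linear_combination p * x * hap - hd

theorem exists_famD_of_coeffs (E F G a b d : ℝ) :
    ∃ g : P2, FamD g ∧ TriangularEquiv
      (fun x y => x ^ 3 + E * x ^ 2 + F * x * y + G * y ^ 2 + (a * x + b * y + d))
      (fun x y => eval ![x, y] g) := by
  by_cases hG : G = 0
  · subst hG
    by_cases hF : F = 0
    · subst hF
      by_cases hb : b = 0
      · subst hb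
        obtain ⟨g, hg, h⟩ := exists_famD_of_cubic (a - E ^ 2 / 3) (2 * E ^ 3 / 27 - a * E / 3 + d)
        refine ⟨g, hg, .trans ⟨1, 1, -E / 3, 0, 0, 1, one_ne_zero, one_ne_zero, one_ne_zero,
          fun x y => ?_⟩ h⟩
        ring
      · refine ⟨_, .inr (.inr (.inr (.inl rfl))), 1, -1 / b, -E / 3, -(a - E ^ 2 / 3) / b,
          -(2 * E ^ 3 / 27 - a * E / 3 + d) / b, 1, one_ne_zero,
          div_ne_zero (by norm_num) hb, one_ne_zero, fun x y => ?_⟩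
        simp
        field_simp
        ring
    · obtain ⟨g, hg, h⟩ := exists_famD_of_cubic_add_mul
        (-(b / F) ^ 3 + E * (b / F) ^ 2 - a * (b / F) + d)
      -- the shift `x ↦ x - b / F` removes the linear term in `y`
      refine ⟨g, hg, .trans (g := fun x y => x ^ 3 + (E - 3 * (b / F)) * x ^ 2
        + (3 * (b / F) ^ 2 - 2 * E * (b / F) + a) * x + F * x * y
        + (-(b / F) ^ 3 + E * (b / F) ^ 2 - a * (b / F) + d))
        ⟨1, 1, -(b / F), 0, 0, 1, one_ne_zero, one_ne_zero, one_ne_zero, fun x y => ?_⟩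
        (.trans ⟨1, -1 / F, 0, -(E - 3 * (b / F)) / F,
          -(3 * (b / F) ^ 2 - 2 * E * (b / F) + a) / F, 1, one_ne_zero,
          div_ne_zero (by norm_num) hF, one_ne_zero, fun x y => ?_⟩ h)⟩
      · field_simp
        ring
      · field_simp
        ring
  · -- completing the square in `y`
    obtain ⟨E', hE'⟩ : ∃ E', E' = E - F ^ 2 / (4 * G) := ⟨_, rfl⟩
    obtain ⟨a', ha'⟩ : ∃ a', a' = a - F * b / (2 * G) := ⟨_, rfl⟩
    obtain ⟨d', hd'⟩ : ∃ d', d' = d - b ^ 2 / (4 * G) := ⟨_, rfl⟩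
    obtain ⟨g, hg, h⟩ := exists_famD_of_cubic_add_sq hG (a' - E' ^ 2 / 3)
      (2 * E' ^ 3 / 27 - a' * E' / 3 + d')
    refine ⟨g, hg, .trans (g := fun x y => x ^ 3 + E' * x ^ 2 + a' * x + G * y ^ 2 + d')
      ⟨1, 1, 0, -F / (2 * G), -b / (2 * G), 1, one_ne_zero, one_ne_zero, one_ne_zero,
        fun x y => ?_⟩
      (.trans ⟨1, 1, -E' / 3, 0, 0, 1, one_ne_zero, one_ne_zero, one_ne_zero,
        fun x y => ?_⟩ h)⟩
    · subst hE' ha' hd'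
      field_simp
      ring
    · ring

theorem stmt3 (E F G : ℝ) (lam : P2) (hlam : lam.totalDegree ≤ 1) :
    ∃ g : P2, FamD g ∧
      AffEquiv (X 0 ^ 3 + C E * X 0 ^ 2 + C F * X 0 * X 1
        + C G * X 1 ^ 2 + lam) g := by
  obtain ⟨a, b, d, hl⟩ := exists_eval_eq_of_totalDegree_le_one hlam
  obtain ⟨g, hg, h⟩ := exists_famD_of_coeffs E F G a b d
  refine ⟨g, hg, TriangularEquiv.affEquiv ?_⟩
  convert h using 3
  simp [hl]
end

section
/- Let f and g each belong to the following family of polynomials in ℝ[x,y]: x³ − x·y² − y² + H·x + I·y + J with J ∈ ℝ, I ≥ 0, and H + I ≤ −3/4; x³ − x·y² − y + H·x + J with J ≥ 0 and −1 ≤ H ≤ 1; x³ − x·y² + 1; x³ − x·y². If f ∼ g, then f = g. -/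
open MvPolynomial

/-- The table entries with canonical form `x³ - x·y²`. -/
def FamB (p : P2) : Prop :=
  (∃ H I J : ℝ, 0 ≤ I ∧ H + I ≤ -(3/4 : ℝ) ∧
    p = X 0 ^ 3 - X 0 * X 1 ^ 2 - X 1 ^ 2 + C H * X 0 + C I * X 1 + C J) ∨
  (∃ H J : ℝ, 0 ≤ J ∧ -1 ≤ H ∧ H ≤ 1 ∧
    p = X 0 ^ 3 - X 0 * X 1 ^ 2 - X 1 + C H * X 0 + C J) ∨
  p = X 0 ^ 3 - X 0 * X 1 ^ 2 + 1 ∨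
  p = X 0 ^ 3 - X 0 * X 1 ^ 2

/-- A ring automorphism of `ℝ[x,y]` fixes the constants. -/
theorem ringEquiv_apply_C (θ : P2 ≃+* P2) (r : ℝ) : θ (C r) = C r := by
  have hid : (constantCoeff.comp (θ.toRingHom.comp C) : ℝ →+* ℝ) = RingHom.id ℝ :=
    Subsingleton.elim _ _
  have hr : constantCoeff (θ (C r)) = r := RingHom.congr_fun hid r
  rcases eq_or_ne r 0 with rfl | h0
  · simp
  · have hu : IsUnit (θ (C r)) := ((isUnit_iff_ne_zero.2 h0).map C).map θ
    obtain ⟨t, -, ht⟩ := isUnit_iff_eq_C_of_isReduced.1 hu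
    rw [ht, constantCoeff_C] at hr
    rw [ht, hr]

/-- A polynomial in `x, y` of total degree at most `1` is an affine form. -/
theorem exists_affine_of_totalDegree_le_one (q : P2) (hq : q.totalDegree ≤ 1) :
    ∃ a b e : ℝ, q = C a * X 0 + C b * X 1 + C e := by
  refine ⟨coeff (Finsupp.single 0 1) q, coeff (Finsupp.single 1 1) q, coeff 0 q, ?_⟩
  have h01 : (Finsupp.single (0 : Fin 2) 1 : Fin 2 →₀ ℕ) ≠ Finsupp.single 1 1 := by
    intro h
    simpa using DFunLike.congr_fun h 0
  have h0 (i : Fin 2) : (Finsupp.single i 1 : Fin 2 →₀ ℕ) ≠ 0 := by simp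
  ext m
  by_cases hm : m ∈ q.support
  · have hdeg := (le_totalDegree hm).trans hq
    rw [Finsupp.sum_fintype _ _ (fun _ => rfl), Fin.sum_univ_two] at hdeg
    have hcases : m = 0 ∨ m = Finsupp.single 0 1 ∨ m = Finsupp.single 1 1 := by
      have : (m 0 = 0 ∧ m 1 = 0) ∨ (m 0 = 1 ∧ m 1 = 0) ∨ (m 0 = 0 ∧ m 1 = 1) := by omega
      rcases this with ⟨h, h'⟩ | ⟨h, h'⟩ | ⟨h, h'⟩
      · left; ext i; fin_cases i <;> simp [h, h']
      · right; left; ext i; fin_cases i <;> simp [h, h']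
      · right; right; ext i; fin_cases i <;> simp [h, h']
    rcases hcases with rfl | rfl | rfl <;>
      simp [coeff_C_mul, coeff_X, coeff_C, h01, h01.symm, (h0 _).symm]
  · have hz : coeff m q = 0 := by simpa using hm
    rw [hz]
    by_cases h1 : m = 0
    · subst h1; simp [coeff_C_mul, coeff_X, hz]
    by_cases h2 : m = Finsupp.single 0 1
    · subst h2; simp [coeff_C_mul, coeff_X, coeff_C, hz, h01.symm, (h0 _).symm]
    by_cases h3 : m = Finsupp.single 1 1
    · subst h3; simp [coeff_C_mul, coeff_X, coeff_C, hz, h01, (h0 _).symm]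
    simp [coeff_C_mul, coeff_X, coeff_C, Ne.symm h1, Ne.symm h2, Ne.symm h3]

/-- The polynomial `x³ - x·y² + p·y² + H·x + I·y + J`. -/
noncomputable def cubicForm (p H I J : ℝ) : P2 :=
  X 0 ^ 3 - X 0 * X 1 ^ 2 + C p * X 1 ^ 2 + C H * X 0 + C I * X 1 + C J

/-- The linear maps `(x, y) ↦ (a x + b y, c x + d y)` that rescale `x³ - x·y²` by a nonzero
factor `l` form the dihedral group of order six, up to the scalar factor `s`. -/
theorem dihedral_of_rescale {a b c d l : ℝ} (hl : l ≠ 0)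
    (h30 : a ^ 3 - a * c ^ 2 = l) (h21 : 3 * a ^ 2 * b - b * c ^ 2 - 2 * a * c * d = 0)
    (h12 : 3 * a * b ^ 2 - a * d ^ 2 - 2 * b * c * d = -l) (h03 : b ^ 3 - b * d ^ 2 = 0) :
    ∃ s β : ℝ, s ≠ 0 ∧ l = s ^ 3 ∧ (β = 1 ∨ β = -1) ∧
      ((a = s ∧ b = 0 ∧ c = 0 ∧ d = β * s) ∨
       (a = -s / 2 ∧ b = -β * s / 2 ∧ c = 3 * s / 2 ∧ d = -β * s / 2) ∨
       (a = -s / 2 ∧ b = -β * s / 2 ∧ c = -3 * s / 2 ∧ d = β * s / 2)) := by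
  have ha : a ≠ 0 := by
    rintro rfl
    apply hl
    rw [← h30]
    ring
  have hsign {z : ℝ} (hz : z ^ 2 = a ^ 2) : ∃ β : ℝ, (β = 1 ∨ β = -1) ∧ z = β * a := by
    rcases sq_eq_sq_iff_eq_or_eq_neg.1 hz with h | h
    · exact ⟨1, Or.inl rfl, by linarith⟩
    · exact ⟨-1, Or.inr rfl, by linarith⟩
  rcases eq_or_ne b 0 with rfl | hb
  · have hd : d ≠ 0 := by
      rintro rfl
      apply hl
      linarith
    have hc : c = 0 := by
      have h : a * d * c = 0 := by linarith
      simpa [ha, hd] using h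
    subst hc
    have hda : d ^ 2 = a ^ 2 := by
      apply mul_left_cancel₀ ha
      linarith
    obtain ⟨β, hβ, h⟩ := hsign hda
    exact ⟨a, β, ha, by linarith, hβ, Or.inl ⟨rfl, rfl, rfl, h⟩⟩
  · have hdb : d ^ 2 = b ^ 2 := by
      apply mul_left_cancel₀ hb
      linarith
    rcases sq_eq_sq_iff_eq_or_eq_neg.1 hdb with rfl | rfl
    · have hac : a - c ≠ 0 := by
        intro h
        apply hl
        rw [← h30]
        linear_combination a * (a + c) * h
      have hc : c = -3 * a := by
        have h : d * (a - c) * (3 * a + c) = 0 := by linear_combination h21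
        have h' : 3 * a + c = 0 := by simpa [hb, hac] using h
        linarith
      subst hc
      have hba : d ^ 2 = a ^ 2 := by
        apply mul_left_cancel₀ ha
        linarith
      obtain ⟨β, hβ, h⟩ := hsign hba
      refine ⟨-2 * a, β, by simpa using ha, by linarith, hβ, Or.inr (Or.inl ?_)⟩
      refine ⟨?_, ?_, ?_, ?_⟩ <;> linarith
    · have hac : a + c ≠ 0 := by
        intro h
        apply hl
        rw [← h30]
        linear_combination a * (a - c) * h
      have hc : c = 3 * a := by
        have h : b * (a + c) * (3 * a - c) = 0 := by linear_combination h21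
        have h' : 3 * a - c = 0 := by simpa [hb, hac] using h
        linarith
      subst hc
      have hba : b ^ 2 = a ^ 2 := by
        apply mul_left_cancel₀ ha
        linarith
      obtain ⟨β, hβ, h⟩ := hsign hba
      refine ⟨-2 * a, β, by simpa using ha, by linarith, hβ, Or.inr (Or.inr ?_)⟩
      refine ⟨?_, ?_, ?_, ?_⟩ <;> linarith

/-- How the coefficients of affinely equivalent polynomials `cubicForm p H I J` are related:
after the shift of `x` which makes the quadratic part a multiple of `x² + y²/3`, they differ by
an element of the dihedral group and a scalar. -/
theorem AffEquiv.cubicForm_relations {p H I J p' H' I' J' : ℝ}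
    (h : AffEquiv (cubicForm p H I J) (cubicForm p' H' I' J')) :
    ∃ s β : ℝ, s ≠ 0 ∧ (β = 1 ∨ β = -1) ∧ p = s * p' ∧
      p ^ 3 / 8 + p * H / 2 + J = s ^ 3 * (p' ^ 3 / 8 + p' * H' / 2 + J') ∧
      ((s ^ 2 * (H' + 3 / 4 * p' ^ 2) = H + 3 / 4 * p ^ 2 ∧ s ^ 2 * I' = β * I) ∨
       (s ^ 2 * (H' + 3 / 4 * p' ^ 2) = -(H + 3 / 4 * p ^ 2 - 3 * I) / 2 ∧
          s ^ 2 * I' = -β * (H + 3 / 4 * p ^ 2 + I) / 2) ∨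
       (s ^ 2 * (H' + 3 / 4 * p' ^ 2) = -(H + 3 / 4 * p ^ 2 + 3 * I) / 2 ∧
          s ^ 2 * I' = -β * (H + 3 / 4 * p ^ 2 - I) / 2)) := by
  obtain ⟨θ, hx, hy, l, hl, h⟩ := h
  obtain ⟨a, b, e, hx⟩ := exists_affine_of_totalDegree_le_one _ hx
  obtain ⟨c, d, k, hy⟩ := exists_affine_of_totalDegree_le_one _ hy
  have key (u v : ℝ) :
      (a * u + b * v + e) ^ 3 - (a * u + b * v + e) * (c * u + d * v + k) ^ 2
        + p * (c * u + d * v + k) ^ 2 + H * (a * u + b * v + e) + I * (c * u + d * v + k) + J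
      = l * (u ^ 3 - u * v ^ 2 + p' * v ^ 2 + H' * u + I' * v + J') := by
    have h' := congrArg (eval ![u, v]) h
    simpa [cubicForm, hx, hy, ringEquiv_apply_C] using h'
  have k00 := key 0 0
  have k10 := key 1 0
  have k20 := key 2 0
  have k30 := key (-1) 0
  have k01 := key 0 1
  have k02 := key 0 2
  have k03 := key 0 (-1)
  have k11 := key 1 1
  have k12 := key 1 (-1)
  have k13 := key (-1) 1
  clear key
  have h30 : a ^ 3 - a * c ^ 2 = l := by linarith
  have h03 : b ^ 3 - b * d ^ 2 = 0 := by linarith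
  have h21 : 3 * a ^ 2 * b - b * c ^ 2 - 2 * a * c * d = 0 := by linarith
  have h12 : 3 * a * b ^ 2 - a * d ^ 2 - 2 * b * c * d = -l := by linarith
  have h20 : 3 * a ^ 2 * e - e * c ^ 2 - 2 * a * c * k + p * c ^ 2 = 0 := by linarith
  have h02 : 3 * b ^ 2 * e - e * d ^ 2 - 2 * b * d * k + p * d ^ 2 = l * p' := by linarith
  have h11 : 6 * a * b * e - 2 * c * d * e - 2 * (a * d + b * c) * k + 2 * p * c * d = 0 := by
    linarith
  have h10 : 3 * a * e ^ 2 - a * k ^ 2 - 2 * c * e * k + 2 * p * c * k + H * a + I * c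
      = l * H' := by linarith
  have h01 : 3 * b * e ^ 2 - b * k ^ 2 - 2 * d * e * k + 2 * p * d * k + H * b + I * d
      = l * I' := by linarith
  have h00 : e ^ 3 - e * k ^ 2 + p * k ^ 2 + H * e + I * k + J = l * J' := by linarith
  clear k00 k10 k20 k30 k01 k02 k03 k11 k12 k13
  obtain ⟨s, β, hs, rfl, hβ, hM⟩ := dihedral_of_rescale hl h30 h21 h12 h03
  clear h30 h21 h12 h03 hl h hx hy
  have hβ2 : β ^ 2 = 1 := by rcases hβ with rfl | rfl <;> norm_num
  have hβ0 : β ≠ 0 := by rcases hβ with rfl | rfl <;> norm_num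
  have hsβ : s ^ 2 * β ≠ 0 := mul_ne_zero (pow_ne_zero 2 hs) hβ0
  have hs2 : s ^ 2 ≠ 0 := pow_ne_zero 2 hs
  rcases hM with ⟨rfl, rfl, rfl, rfl⟩ | ⟨rfl, rfl, rfl, rfl⟩ | ⟨rfl, rfl, rfl, rfl⟩
  · have he : e = 0 := by
      apply mul_left_cancel₀ hs2
      linear_combination h20 / 3
    have hk : k = 0 := by
      apply mul_left_cancel₀ hsβ
      linear_combination -h11 / 2
    subst he hk
    have hp : p = a * p' := by
      apply mul_left_cancel₀ hs2
      linear_combination h02 - p * a ^ 2 * hβ2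
    subst hp
    refine ⟨a, β, hs, hβ, rfl, ?_, Or.inl ⟨?_, ?_⟩⟩
    · have h10' : a ^ 2 * H' = H := by
        apply mul_left_cancel₀ hs
        linear_combination -h10
      linear_combination h00 - a * p' / 2 * h10'
    · apply mul_left_cancel₀ hs
      linear_combination -h10
    · apply mul_left_cancel₀ hs
      linear_combination -h01
  · have hE : 3 * e = 3 * k + 9 / 2 * p := by
      apply mul_left_cancel₀ hs2
      linear_combination -2 * h20
    have hK : 3 * e + k = 3 / 2 * p := by
      apply mul_left_cancel₀ hsβ
      linear_combination h11
    have he : e = 3 / 4 * p := by linarith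
    have hk : k = -3 / 4 * p := by linarith
    clear hE hK
    subst he hk
    have hp : p = s * p' := by
      apply mul_left_cancel₀ hs2
      linear_combination h02 - p * s ^ 2 * hβ2
    subst hp
    have h1 : s ^ 2 * (H' + 3 / 4 * p' ^ 2) = -(H + 3 / 4 * (s * p') ^ 2 - 3 * I) / 2 := by
      apply mul_left_cancel₀ hs
      linear_combination -h10
    refine ⟨s, β, hs, hβ, rfl, ?_, Or.inr (Or.inl ⟨h1, ?_⟩)⟩
    · linear_combination h00 - s * p' / 2 * h1
    · apply mul_left_cancel₀ hs
      linear_combination -h01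
  · have hE : 3 * e = -3 * k + 9 / 2 * p := by
      apply mul_left_cancel₀ hs2
      linear_combination -2 * h20
    have hK : 3 * e - k = 3 / 2 * p := by
      apply mul_left_cancel₀ hsβ
      linear_combination h11
    have he : e = 3 / 4 * p := by linarith
    have hk : k = 3 / 4 * p := by linarith
    clear hE hK
    subst he hk
    have hp : p = s * p' := by
      apply mul_left_cancel₀ hs2
      linear_combination h02 - p * s ^ 2 * hβ2
    subst hp
    have h1 : s ^ 2 * (H' + 3 / 4 * p' ^ 2) = -(H + 3 / 4 * (s * p') ^ 2 + 3 * I) / 2 := by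
      apply mul_left_cancel₀ hs
      linear_combination -h10
    refine ⟨s, β, hs, hβ, rfl, ?_, Or.inr (Or.inr ⟨h1, ?_⟩)⟩
    · linear_combination h00 - s * p' / 2 * h1
    · apply mul_left_cancel₀ hs
      linear_combination -h01

/-- Every member of the family is a `cubicForm` with coefficients in a fundamental domain. -/
theorem FamB.exists_cubicForm {f : P2} (hf : FamB f) :
    ∃ p H I J : ℝ, f = cubicForm p H I J ∧
      ((p = -1 ∧ 0 ≤ I ∧ H + I ≤ -(3 / 4)) ∨
       (p = 0 ∧ I = -1 ∧ 0 ≤ J ∧ -1 ≤ H ∧ H ≤ 1) ∨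
       (p = 0 ∧ I = 0 ∧ H = 0 ∧ (J = 1 ∨ J = 0))) := by
  rcases hf with ⟨H, I, J, hI, hH, rfl⟩ | ⟨H, J, hJ, hH, hH', rfl⟩ | rfl | rfl
  · exact ⟨-1, H, I, J, by simp [cubicForm]; ring, Or.inl ⟨rfl, hI, hH⟩⟩
  · exact ⟨0, H, -1, J, by simp [cubicForm]; ring, Or.inr (Or.inl ⟨rfl, rfl, hJ, hH, hH'⟩)⟩
  · exact ⟨0, 0, 0, 1, by simp [cubicForm], Or.inr (Or.inr ⟨rfl, rfl, rfl, Or.inl rfl⟩)⟩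
  · exact ⟨0, 0, 0, 0, by simp [cubicForm], Or.inr (Or.inr ⟨rfl, rfl, rfl, Or.inr rfl⟩)⟩

theorem stmt5 (f g : P2) (hf : FamB f) (hg : FamB g) (h : AffEquiv f g) :
    f = g := by
  obtain ⟨p, H, I, J, rfl, hfc⟩ := hf.exists_cubicForm
  obtain ⟨p', H', I', J', rfl, hgc⟩ := hg.exists_cubicForm
  obtain ⟨s, β, hs, hβ, hp, hK, hL⟩ := h.cubicForm_relations
  have hs2 : 0 < s ^ 2 := by positivity
  clear hf hg h
  rcases hfc with ⟨rfl, hI, hH⟩ | ⟨rfl, rfl, hJ, hH, hH1⟩ | ⟨rfl, rfl, rfl, hJ⟩ <;>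
    rcases hgc with ⟨rfl, hI', hH'⟩ | ⟨rfl, rfl, hJ', hH', hH1'⟩ | ⟨rfl, rfl, rfl, hJ'⟩
  · obtain rfl : s = 1 := by linarith
    have hHI : H = H' ∧ I = I' := by
      rcases hβ with rfl | rfl <;> rcases hL with ⟨h1, h2⟩ | ⟨h1, h2⟩ | ⟨h1, h2⟩ <;>
        constructor <;> linarith
    obtain ⟨rfl, rfl⟩ := hHI
    obtain rfl : J = J' := by linarith
    rfl
  · norm_num at hp
  · norm_num at hp
  · exact absurd hp (by simpa using hs)
  · have hH : H = H' ∧ s ^ 2 = 1 := by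
      have hb : 0 ≤ s ^ 2 * (1 - H') := mul_nonneg hs2.le (by linarith)
      have hb' : 0 ≤ s ^ 2 * (1 + H') := mul_nonneg hs2.le (by linarith)
      have hs1 : s ^ 2 = 1 := by
        rcases hβ with rfl | rfl <;> rcases hL with ⟨h1, h2⟩ | ⟨h1, h2⟩ | ⟨h1, h2⟩ <;> linarith
      rw [hs1] at hL
      refine ⟨?_, hs1⟩
      rcases hβ with rfl | rfl <;> rcases hL with ⟨h1, h2⟩ | ⟨h1, h2⟩ | ⟨h1, h2⟩ <;> linarith
    obtain ⟨rfl, hs1⟩ := hH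
    obtain rfl : J = J' := by
      rcases sq_eq_sq_iff_eq_or_eq_neg.1 (hs1.trans (one_pow 2).symm) with rfl | rfl <;> linarith
    rfl
  · exfalso
    rcases hβ with rfl | rfl <;> rcases hL with ⟨h1, h2⟩ | ⟨h1, h2⟩ | ⟨h1, h2⟩ <;> linarith
  · exact absurd hp (by simpa using hs)
  · exfalso
    rcases hL with ⟨h1, h2⟩ | ⟨h1, h2⟩ | ⟨h1, h2⟩ <;> linarith
  · have hs3 : s ^ 3 ≠ 0 := pow_ne_zero 3 hs
    rcases hJ with rfl | rfl <;> rcases hJ' with rfl | rfl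
    · rfl
    · norm_num at hK
    · exact absurd hK.symm (by simpa using hs)
    · rfl
end
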